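/- Let C be a finite set of candidate communities with a real-valued influence score σ : C → ℝ, let M be a positive integer and θ a real threshold. Suppose there exists a subset T ⊆ C with |T| = M such that σ(t) ≥ θ for every t ∈ T, and suppose a candidate S ∈ C \ T satisfies σ(S) ≤ ub for some real ub with ub < θ. Then S does not belong to any top-M set of C, where a top-M set is a subset L ⊆ C with |L| = M such that σ(x) ≥ σ(y) for every x ∈ L and every y ∈ C \ L. -/

import Mathlib

/-- Influence Score Pruning (Lemma 3): if there are M candidates with influence score
at least θ, then any other candidate whose influence upper bound is below θ cannot
belong to any top-M set. -/
theorem influence_score_pruning {α : Type*} [DecidableEq α] (C : Finset α) (σ : α → ℝ)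
    (M : ℕ) (hM : 0 < M) (θ ub : ℝ)
    (T : Finset α) (hTsub : T ⊆ C) (hTcard : T.card = M)
    (hTθ : ∀ t ∈ T, θ ≤ σ t)
    (S : α) (hSC : S ∈ C) (hST : S ∉ T)
    (hub : σ S ≤ ub) (hubθ : ub < θ) :
    ∀ L : Finset α, L ⊆ C → L.card = M →
      (∀ x ∈ L, ∀ y ∈ C, y ∉ L → σ y ≤ σ x) → S ∉ L := by
  intro L _ hLcard hL hSL
  have hTL : T ⊆ L := by
    intro t ht
    by_contra htL
    linarith [hTθ t ht, hL S hSL t (hTsub ht) htL]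
  have hTL_eq : T = L := Finset.eq_of_subset_of_card_le hTL (by rw [hLcard, hTcard])
  exact hST (hTL_eq ▸ hSL)
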